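/- Let f : ℝ → ℝ be convex. Then the map (x,t) ↦ M_f(x;t) is a (finite-valued) jointly convex function on ℝ × (0,∞). -/

import Mathlib

/-- The Moreau envelope `M_f(x; t) = ⨅ v, (f v + (x - v)^2 / (2t))`. -/
noncomputable def moreau (f : ℝ → ℝ) (x t : ℝ) : ℝ := ⨅ v : ℝ, (f v + (x - v) ^ 2 / (2 * t))

theorem sq_div_two_mul_ge_affine {s : ℝ} (hs : 0 < s) (u m : ℝ) :
    m * u - m ^ 2 * s / 2 ≤ u ^ 2 / (2 * s) := by
  rw [le_div_iff₀ (by positivity)]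
  nlinarith [sq_nonneg (u - m * s)]

theorem sq_div_two_mul_jointly_convex {s₁ s₂ a b : ℝ} (h₁ : 0 < s₁) (h₂ : 0 < s₂)
    (ha : 0 ≤ a) (hb : 0 ≤ b) (hs : 0 < a * s₁ + b * s₂) (u₁ u₂ : ℝ) :
    (a * u₁ + b * u₂) ^ 2 / (2 * (a * s₁ + b * s₂)) ≤
      a * (u₁ ^ 2 / (2 * s₁)) + b * (u₂ ^ 2 / (2 * s₂)) := by
  obtain ⟨m, hm⟩ : ∃ m, a * u₁ + b * u₂ = m * (a * s₁ + b * s₂) :=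
    ⟨(a * u₁ + b * u₂) / (a * s₁ + b * s₂), by field_simp⟩
  have e : (a * u₁ + b * u₂) ^ 2 / (2 * (a * s₁ + b * s₂)) =
      m * (a * u₁ + b * u₂) - m ^ 2 * (a * s₁ + b * s₂) / 2 := by
    rw [hm]
    field_simp
    ring
  rw [e]
  linarith [mul_le_mul_of_nonneg_left (sq_div_two_mul_ge_affine h₁ u₁ m) ha,
    mul_le_mul_of_nonneg_left (sq_div_two_mul_ge_affine h₂ u₂ m) hb]

theorem ConvexOn.bddBelow_range_moreau {f : ℝ → ℝ} (hf : ConvexOn ℝ Set.univ f) (x : ℝ)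
    {t : ℝ} (ht : 0 < t) :
    BddBelow (Set.range fun v : ℝ => f v + (x - v) ^ 2 / (2 * t)) := by
  obtain ⟨c, d, h⟩ := hf.exists_affine_le_real isClosed_univ
    (hf.continuousOn isOpen_univ).lowerSemicontinuousOn
  refine ⟨c * x + d - c ^ 2 * t / 2, ?_⟩
  rintro _ ⟨v, rfl⟩
  linarith [h v (Set.mem_univ v), sq_div_two_mul_ge_affine ht (x - v) c]

/-- For convex `f : ℝ → ℝ`, the map `(x, t) ↦ M_f(x; t)` is a (finite-valued)
jointly convex function on `ℝ × (0, ∞)`. -/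
theorem stmt1 (f : ℝ → ℝ) (hconv : ConvexOn ℝ Set.univ f) :
    ConvexOn ℝ (Set.univ ×ˢ Set.Ioi (0 : ℝ)) (fun p : ℝ × ℝ => moreau f p.1 p.2) := by
  have hdom : Convex ℝ (Set.univ ×ˢ Set.Ioi (0 : ℝ) : Set (ℝ × ℝ)) :=
    convex_univ.prod (convex_Ioi 0)
  refine ⟨hdom, ?_⟩
  rintro ⟨x, s⟩ hp ⟨y, t⟩ hq a b ha hb hab
  have hst : 0 < a * s + b * t := (hdom hp hq ha hb hab).2
  have hs : 0 < s := hp.2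
  have ht : 0 < t := hq.2
  simp only [moreau, Prod.smul_mk, Prod.mk_add_mk, smul_eq_mul]
  rw [Real.mul_iInf_of_nonneg ha, Real.mul_iInf_of_nonneg hb]
  refine le_ciInf_add_ciInf fun v w => ?_
  refine (ciInf_le (hconv.bddBelow_range_moreau _ hst) (a * v + b * w)).trans ?_
  have hfvw : f (a * v + b * w) ≤ a * f v + b * f w :=
    hconv.2 (Set.mem_univ v) (Set.mem_univ w) ha hb hab
  have hsq := sq_div_two_mul_jointly_convex hs ht ha hb hst (x - v) (y - w)
  rw [show a * x + b * y - (a * v + b * w) = a * (x - v) + b * (y - w) by ring]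
  linarith
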